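/- Let n ≥ 1, let μ ∈ A₁, let 0 < β < 1, let 1 < p < n/β, define q by 1/q = 1/p − β/n, and let 0 < κ < p/q. Then there exists a constant C > 0 such that for every b ∈ Lip_{β,μ} and every f ∈ L^{p,κ}(μ), ‖M_b(f)‖_{L^{q,κq/p}(μ^{1−q},μ)} ≤ C ‖b‖_{Lip_{β,μ}} ‖f‖_{L^{p,κ}(μ)}. -/

import Mathlib

open MeasureTheory

noncomputable section

/-- An axis-parallel cube in `ℝⁿ` (with positive side length). -/
def IsCube {n : ℕ} (Q : Set (Fin n → ℝ)) : Prop :=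
  ∃ (a : Fin n → ℝ) (h : ℝ), 0 < h ∧ Q = Set.univ.pi fun i => Set.Icc (a i) (a i + h)

/-- The average `f_Q = |Q|⁻¹ ∫_Q f` of `f` over `Q`. -/
def cubeAvg {n : ℕ} (Q : Set (Fin n → ℝ)) (f : (Fin n → ℝ) → ℝ) : ℝ :=
  (MeasureTheory.volume Q).toReal⁻¹ * ∫ y in Q, f y

/-- A weight: a nonnegative locally integrable function, positive a.e. -/
def IsWeight {n : ℕ} (μ : (Fin n → ℝ) → ℝ) : Prop :=
  MeasureTheory.LocallyIntegrable μ ∧ (∀ x, 0 ≤ μ x) ∧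
    ∀ᵐ x ∂(MeasureTheory.volume : Measure (Fin n → ℝ)), 0 < μ x

/-- The Muckenhoupt `A₁` class. -/
def IsA1 {n : ℕ} (μ : (Fin n → ℝ) → ℝ) : Prop :=
  IsWeight μ ∧ ∃ C > 0, ∀ Q : Set (Fin n → ℝ), IsCube Q →
    ∀ᵐ x ∂(MeasureTheory.volume.restrict Q), cubeAvg Q μ ≤ C * μ x

/-- The Muckenhoupt `A_p` class for `1 < p < ∞`. -/
def IsAp {n : ℕ} (μ : (Fin n → ℝ) → ℝ) (p : ℝ) : Prop :=
  IsWeight μ ∧ ∃ C : ℝ, ∀ Q : Set (Fin n → ℝ), IsCube Q →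
    cubeAvg Q μ * (cubeAvg Q fun x => μ x ^ (1 - p / (p - 1))) ^ (p - 1) ≤ C

/-- The Muckenhoupt `A_∞` class, `A_∞ = ⋃_{1 ≤ p < ∞} A_p`. -/
def IsAinfty {n : ℕ} (μ : (Fin n → ℝ) → ℝ) : Prop :=
  IsA1 μ ∨ ∃ p : ℝ, 1 < p ∧ IsAp μ p

/-- The set of quantities defining the weighted Lipschitz norm of `b`. -/
def lipSet {n : ℕ} (β : ℝ) (μ b : (Fin n → ℝ) → ℝ) : Set ℝ :=
  { r | ∃ Q : Set (Fin n → ℝ), IsCube Q ∧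
      r = (∫ x in Q, μ x) ^ (-(β / (n : ℝ))) * (∫ x in Q, μ x)⁻¹ *
            ∫ x in Q, |b x - cubeAvg Q b| }

/-- The weighted Lipschitz norm `‖b‖_{Lip_{β,μ}}`. -/
def lipNorm {n : ℕ} (β : ℝ) (μ b : (Fin n → ℝ) → ℝ) : ℝ := sSup (lipSet β μ b)

/-- Membership `b ∈ Lip_{β,μ}`. -/
def MemLip {n : ℕ} (β : ℝ) (μ b : (Fin n → ℝ) → ℝ) : Prop :=
  MeasureTheory.LocallyIntegrable b ∧ BddAbove (lipSet β μ b)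

/-- The set of averages defining the Hardy–Littlewood maximal function at `x`. -/
def hlMaxSet {n : ℕ} (f : (Fin n → ℝ) → ℝ) (x : Fin n → ℝ) : Set ℝ :=
  { r | ∃ Q : Set (Fin n → ℝ), IsCube Q ∧ x ∈ Q ∧
      r = (MeasureTheory.volume Q).toReal⁻¹ * ∫ y in Q, |f y| }

/-- The Hardy–Littlewood maximal function `M(f)(x)`. -/
def hlMax {n : ℕ} (f : (Fin n → ℝ) → ℝ) (x : Fin n → ℝ) : ℝ := sSup (hlMaxSet f x)

/-- The set of quantities defining the sharp maximal function at `x`. -/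
def sharpMaxSet {n : ℕ} (f : (Fin n → ℝ) → ℝ) (x : Fin n → ℝ) : Set ℝ :=
  { r | ∃ Q : Set (Fin n → ℝ), IsCube Q ∧ x ∈ Q ∧
      r = (MeasureTheory.volume Q).toReal⁻¹ * ∫ y in Q, |f y - cubeAvg Q f| }

/-- The sharp maximal function `M♯(f)(x)`. -/
def sharpMax {n : ℕ} (f : (Fin n → ℝ) → ℝ) (x : Fin n → ℝ) : ℝ := sSup (sharpMaxSet f x)

/-- The local maximal function `M_{Q₀}(f)(x)` relative to a cube `Q₀`. -/
def localMax {n : ℕ} (Q₀ : Set (Fin n → ℝ)) (f : (Fin n → ℝ) → ℝ) (x : Fin n → ℝ) : ℝ :=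
  sSup { r | ∃ Q : Set (Fin n → ℝ), IsCube Q ∧ Q ⊆ Q₀ ∧ x ∈ Q ∧
      r = (MeasureTheory.volume Q).toReal⁻¹ * ∫ y in Q, |f y| }

/-- The maximal commutator `M_b(f)(x)`. -/
def maxCommutator {n : ℕ} (b f : (Fin n → ℝ) → ℝ) (x : Fin n → ℝ) : ℝ :=
  sSup { r | ∃ Q : Set (Fin n → ℝ), IsCube Q ∧ x ∈ Q ∧
      r = (MeasureTheory.volume Q).toReal⁻¹ * ∫ y in Q, |b x - b y| * |f y| }

/-- The (nonlinear) commutator `[b, M](f)(x) = b(x) M(f)(x) - M(bf)(x)`. -/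
def commM {n : ℕ} (b f : (Fin n → ℝ) → ℝ) (x : Fin n → ℝ) : ℝ :=
  b x * hlMax f x - hlMax (fun y => b y * f y) x

/-- The commutator `[b, M♯](f)(x) = b(x) M♯(f)(x) - M♯(bf)(x)`. -/
def commSharp {n : ℕ} (b f : (Fin n → ℝ) → ℝ) (x : Fin n → ℝ) : ℝ :=
  b x * sharpMax f x - sharpMax (fun y => b y * f y) x

/-- The weighted fractional maximal function `M_{β,μ,r}(f)(x)`. -/
def fracMax {n : ℕ} (β : ℝ) (μ : (Fin n → ℝ) → ℝ) (r : ℝ) (f : (Fin n → ℝ) → ℝ)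
    (x : Fin n → ℝ) : ℝ :=
  sSup { t | ∃ Q : Set (Fin n → ℝ), IsCube Q ∧ x ∈ Q ∧
      t = ((∫ y in Q, μ y) ^ (-(1 - r * β / (n : ℝ))) * ∫ y in Q, |f y| ^ r * μ y) ^ (1 / r) }

/-- The two-weight Morrey norm `‖f‖_{L^{p,κ}(u,v)}`. -/
def morreyNorm2 {n : ℕ} (p κ : ℝ) (u v f : (Fin n → ℝ) → ℝ) : ℝ :=
  sSup { r | ∃ Q : Set (Fin n → ℝ), IsCube Q ∧
      r = ((∫ x in Q, v x) ^ (-κ) * ∫ x in Q, |f x| ^ p * u x) ^ (1 / p) }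

/-- The one-weight Morrey norm `‖f‖_{L^{p,κ}(μ)}`. -/
def morreyNorm {n : ℕ} (p κ : ℝ) (μ f : (Fin n → ℝ) → ℝ) : ℝ := morreyNorm2 p κ μ μ f

/-- Membership `f ∈ L^{p,κ}(μ)`: local `L^p(μ)`-integrability and finiteness of the norm. -/
def MemMorrey {n : ℕ} (p κ : ℝ) (μ f : (Fin n → ℝ) → ℝ) : Prop :=
  (∀ Q : Set (Fin n → ℝ), IsCube Q →
      MeasureTheory.IntegrableOn (fun x => |f x| ^ p * μ x) Q) ∧
  BddAbove { r | ∃ Q : Set (Fin n → ℝ), IsCube Q ∧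
      r = ((∫ x in Q, μ x) ^ (-κ) * ∫ x in Q, |f x| ^ p * μ x) ^ (1 / p) }

/-! ### A maximal theorem for doubling measures along a countable family of balls -/

/-- Maximal function along a family of balls. -/
def famMax {α ι : Type*} [PseudoMetricSpace α] [MeasurableSpace α] (ν : Measure α)
    (c : ι → α) (r : ι → ℝ) (F : α → ENNReal) (x : α) : ENNReal :=
  ⨆ i, (Metric.closedBall (c i) (r i)).indicator
    (fun _ => (ν (Metric.closedBall (c i) (r i)))⁻¹ * ∫⁻ y in Metric.closedBall (c i) (r i), F y ∂ν) x

lemma famMax_measurable {α ι : Type*} [PseudoMetricSpace α] [MeasurableSpace α] [BorelSpace α]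
    [Countable ι] (ν : Measure α) (c : ι → α) (r : ι → ℝ) (F : α → ENNReal) :
    Measurable (famMax ν c r F) := by
  unfold famMax
  refine Measurable.iSup fun i => ?_
  exact measurable_const.indicator Metric.isClosed_closedBall.measurableSet

lemma famMax_weak {α ι : Type*} [PseudoMetricSpace α] [MeasurableSpace α] [BorelSpace α]
    [Countable ι] (ν : Measure α) (A : ENNReal)
    (c : ι → α) (r : ι → ℝ) (R : ℝ) (hR : ∀ i, r i ≤ R)
    (hpos : ∀ i, ν (Metric.closedBall (c i) (r i)) ≠ 0)
    (hfin : ∀ i, ν (Metric.closedBall (c i) (r i)) ≠ ⊤)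
    (hdoub : ∀ i, ν (Metric.closedBall (c i) (5 * r i)) ≤ A * ν (Metric.closedBall (c i) (r i)))
    (F : α → ENNReal) (hF : Measurable F) (t : ENNReal) (ht0 : t ≠ 0) (htt : t ≠ ⊤) :
    ν {x | t < famMax ν c r F x} ≤ A * (2 * t⁻¹ * ∫⁻ x in {x | t / 2 < F x}, F x ∂ν) := by
  set B : ι → Set α := fun i => Metric.closedBall (c i) (r i) with hB
  set S : Set ι := {i | t < (ν (B i))⁻¹ * ∫⁻ y in B i, F y ∂ν} with hS
  have hBm : ∀ i, MeasurableSet (B i) := fun i => Metric.isClosed_closedBall.measurableSet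
  have hEm : MeasurableSet {x | t / 2 < F x} := measurableSet_lt measurable_const hF
  set F' : α → ENNReal := {x | t / 2 < F x}.indicator F with hF'
  have hF'm : Measurable F' := hF.indicator hEm
  -- each selected ball
  have key : ∀ i ∈ S, ν (B i) ≤ 2 * t⁻¹ * ∫⁻ x in B i, F' x ∂ν := by
    intro i hi
    have h1 : t * ν (B i) ≤ ∫⁻ y in B i, F y ∂ν := by
      have hi' : t < (ν (B i))⁻¹ * ∫⁻ y in B i, F y ∂ν := hi
      have := mul_le_mul_left hi'.le (ν (B i))
      calc t * ν (B i) ≤ (ν (B i))⁻¹ * (∫⁻ y in B i, F y ∂ν) * ν (B i) := by gcongr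
        _ = ((ν (B i))⁻¹ * ν (B i)) * ∫⁻ y in B i, F y ∂ν := by ring
        _ = _ := by rw [ENNReal.inv_mul_cancel (hpos i) (hfin i), one_mul]
    have h2 : ∫⁻ y in B i, F y ∂ν ≤ (∫⁻ y in B i, F' y ∂ν) + t / 2 * ν (B i) := by
      calc ∫⁻ y in B i, F y ∂ν ≤ ∫⁻ y in B i, (F' y + t / 2) ∂ν := by
            refine lintegral_mono fun y => ?_
            by_cases hy : t / 2 < F y
            · have : F' y = F y := Set.indicator_of_mem (s := {x | t / 2 < F x}) hy F
              simp only [this]; exact le_self_add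
            · exact (not_lt.1 hy).trans le_add_self
        _ = _ := by rw [lintegral_add_left hF'm]; simp
    have h3 : t / 2 * ν (B i) ≤ ∫⁻ y in B i, F' y ∂ν := by
      have h4 : t * ν (B i) = t / 2 * ν (B i) + t / 2 * ν (B i) := by
        rw [← add_mul, ENNReal.add_halves]
      rw [h4] at h1
      refine (ENNReal.add_le_add_iff_right ?_).1 (h1.trans h2)
      exact ENNReal.mul_ne_top (ENNReal.div_ne_top htt (by simp)) (hfin i)
    calc ν (B i) = 2 * t⁻¹ * (t / 2 * ν (B i)) := by
          rw [← mul_assoc]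
          have : 2 * t⁻¹ * (t / 2) = 1 := by
            rw [div_eq_mul_inv]
            calc 2 * t⁻¹ * (t * 2⁻¹) = (t⁻¹ * t) * (2 * 2⁻¹) := by ring
              _ = 1 := by
                rw [ENNReal.inv_mul_cancel ht0 htt, ENNReal.mul_inv_cancel (by simp) (by simp), one_mul]
          rw [this, one_mul]
      _ ≤ _ := by gcongr
  obtain ⟨u, huS, hdisj, hcov⟩ :=
    Vitali.exists_disjoint_subfamily_covering_enlargement_closedBall S c r R (fun a _ => hR a) 5
      (by norm_num)
  have hsub : {x | t < famMax ν c r F x} ⊆ ⋃ j ∈ u, Metric.closedBall (c j) (5 * r j) := by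
    intro x hx
    obtain ⟨i, hi⟩ := lt_iSup_iff.1 (show t < famMax ν c r F x from hx)
    have hxi : x ∈ B i := by
      by_contra h
      rw [Set.indicator_of_notMem h] at hi
      exact not_lt_bot hi
    rw [Set.indicator_of_mem hxi] at hi
    obtain ⟨j, hj, hij⟩ := hcov i hi
    exact Set.mem_biUnion hj (hij hxi)
  have huc : u.Countable := Set.to_countable u
  calc ν {x | t < famMax ν c r F x} ≤ ν (⋃ j ∈ u, Metric.closedBall (c j) (5 * r j)) :=
        measure_mono hsub
    _ ≤ ∑' j : u, ν (Metric.closedBall (c j) (5 * r j)) := measure_biUnion_le _ huc _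
    _ ≤ ∑' j : u, A * (2 * t⁻¹ * ∫⁻ x in B j, F' x ∂ν) := by
        refine ENNReal.tsum_le_tsum fun j => (hdoub j).trans ?_
        gcongr
        exact key j (huS j.2)
    _ = A * (2 * t⁻¹ * ∫⁻ x in ⋃ j ∈ u, B j, F' x ∂ν) := by
        rw [ENNReal.tsum_mul_left, ENNReal.tsum_mul_left,
          lintegral_biUnion huc (fun i _ => hBm i) hdisj]
    _ ≤ A * (2 * t⁻¹ * ∫⁻ x, F' x ∂ν) := by
        gcongr
        exact Measure.restrict_le_self
    _ = _ := by rw [hF', lintegral_indicator hEm]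

lemma famMax_finite {α ι : Type*} [PseudoMetricSpace α] [MeasurableSpace α] [BorelSpace α]
    [Countable ι] (ν : Measure α) (A : ENNReal) (hA : A ≠ ⊤)
    (c : ι → α) (r : ι → ℝ) (R : ℝ) (hR : ∀ i, r i ≤ R)
    (hpos : ∀ i, ν (Metric.closedBall (c i) (r i)) ≠ 0)
    (hfin : ∀ i, ν (Metric.closedBall (c i) (r i)) ≠ ⊤)
    (hdoub : ∀ i, ν (Metric.closedBall (c i) (5 * r i)) ≤ A * ν (Metric.closedBall (c i) (r i)))
    (F : α → ENNReal) (hF : Measurable F) (hFi : ∫⁻ x, F x ∂ν ≠ ⊤) :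
    ∀ᵐ x ∂ν, famMax ν c r F x < ⊤ := by
  have h : ∀ k : ℕ, ν {x | famMax ν c r F x = ⊤} ≤
      (A * (2 * ∫⁻ x, F x ∂ν)) * ((k + 1 : ℕ) : ENNReal)⁻¹ := by
    intro k
    calc ν {x | famMax ν c r F x = ⊤} ≤ ν {x | ((k + 1 : ℕ) : ENNReal) < famMax ν c r F x} := by
          refine measure_mono fun x hx => ?_
          simp only [Set.mem_ofPred_eq] at hx ⊢
          rw [hx]; exact ENNReal.natCast_lt_top _
      _ ≤ _ := famMax_weak ν A c r R hR hpos hfin hdoub F hF _ (by simp) (ENNReal.natCast_ne_top _)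
      _ ≤ A * (2 * ((k + 1 : ℕ) : ENNReal)⁻¹ * ∫⁻ x, F x ∂ν) := by
          gcongr
          exact Measure.restrict_le_self
      _ = _ := by ring
  have h0 : ν {x | famMax ν c r F x = ⊤} = 0 := by
    have ht : Filter.Tendsto (fun k : ℕ => (A * (2 * ∫⁻ x, F x ∂ν)) * ((k + 1 : ℕ) : ENNReal)⁻¹)
        Filter.atTop (nhds ((A * (2 * ∫⁻ x, F x ∂ν)) * 0)) := by
      refine ENNReal.Tendsto.const_mul ?_ (Or.inr ?_)
      · exact (Filter.tendsto_add_atTop_iff_nat 1).2 ENNReal.tendsto_inv_nat_nhds_zero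
      · exact ENNReal.mul_ne_top hA (ENNReal.mul_ne_top (by simp) hFi)
    rw [mul_zero] at ht
    exact le_antisymm (ge_of_tendsto' ht h) (zero_le)
  have : ∀ᵐ x ∂ν, famMax ν c r F x ≠ ⊤ := by
    rw [ae_iff]; simpa using h0
  filter_upwards [this] with x hx using lt_top_iff_ne_top.2 hx

lemma famMax_strong {α ι : Type*} [PseudoMetricSpace α] [MeasurableSpace α] [BorelSpace α]
    [Countable ι] (ν : Measure α) (A : ENNReal) (hA : A ≠ ⊤)
    (c : ι → α) (r : ι → ℝ) (R : ℝ) (hR : ∀ i, r i ≤ R)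
    (hpos : ∀ i, ν (Metric.closedBall (c i) (r i)) ≠ 0)
    (hfin : ∀ i, ν (Metric.closedBall (c i) (r i)) ≠ ⊤)
    (hdoub : ∀ i, ν (Metric.closedBall (c i) (5 * r i)) ≤ A * ν (Metric.closedBall (c i) (r i)))
    (φ : α → ℝ) (hφ : Measurable φ) (hφ0 : ∀ x, 0 ≤ φ x)
    (hFi : ∫⁻ x, ENNReal.ofReal (φ x) ∂ν ≠ ⊤) (p : ℝ) (hp : 1 < p) :
    ∫⁻ x, ENNReal.ofReal ((famMax ν c r (fun x => ENNReal.ofReal (φ x)) x).toReal ^ p) ∂ν ≤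
      ENNReal.ofReal p * A * 2 * ENNReal.ofReal (2 ^ (p - 1) / (p - 1)) *
        ∫⁻ x, ENNReal.ofReal (φ x ^ p) ∂ν := by
  set F : α → ENNReal := fun x => ENNReal.ofReal (φ x) with hFdef
  have hF : Measurable F := hφ.ennreal_ofReal
  have hMm := famMax_measurable ν c r F
  have hMf := famMax_finite ν A hA c r R hR hpos hfin hdoub F hF hFi
  set ν' := ν.withDensity F with hν'
  rw [lintegral_rpow_eq_lintegral_meas_lt_mul ν (Filter.Eventually.of_forall fun x => ENNReal.toReal_nonneg)
    hMm.ennreal_toReal.aemeasurable (by linarith : 0 < p)]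
  have hlc := lintegral_rpow_eq_lintegral_meas_lt_mul ν' (f := fun x => 2 * φ x)
    (Filter.Eventually.of_forall fun x => by simpa using hφ0 x)
    (by fun_prop) (p := p - 1) (by linarith)
  have hp1 : ENNReal.ofReal (p - 1) ≠ 0 := by simpa using hp
  have hle : ∫⁻ t in Set.Ioi (0 : ℝ), ν {a | t < (famMax ν c r F a).toReal} *
      ENNReal.ofReal (t ^ (p - 1)) ≤
      A * 2 * ∫⁻ t in Set.Ioi (0 : ℝ), ν' {a | t < 2 * φ a} * ENNReal.ofReal (t ^ (p - 1 - 1)) := by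
    rw [← lintegral_const_mul' _ _ (ENNReal.mul_ne_top hA (by simp))]
    refine setLIntegral_mono' measurableSet_Ioi fun t ht => ?_
    have ht' : 0 < t := ht
    have hset : {x | ENNReal.ofReal t / 2 < F x} = {a | t < 2 * φ a} := by
      ext x
      simp only [Set.mem_ofPred_eq, hFdef]
      rw [show (2 : ENNReal) = ENNReal.ofReal 2 by simp, ← ENNReal.ofReal_div_of_pos (by norm_num),
        ENNReal.ofReal_lt_ofReal_iff']
      constructor
      · rintro ⟨h, _⟩; linarith
      · intro h; exact ⟨by linarith, by linarith⟩
    have hw : ν {a | t < (famMax ν c r F a).toReal} ≤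
        A * (2 * (ENNReal.ofReal t)⁻¹ * ν' {a | t < 2 * φ a}) := by
      calc ν {a | t < (famMax ν c r F a).toReal} ≤ ν {a | ENNReal.ofReal t < famMax ν c r F a} := by
            refine measure_mono fun x hx => ?_
            simp only [Set.mem_ofPred_eq] at hx ⊢
            by_cases htop : famMax ν c r F x = ⊤
            · rw [htop]; exact ENNReal.ofReal_lt_top
            · exact (ENNReal.ofReal_lt_iff_lt_toReal ht'.le htop).2 hx
        _ ≤ _ := famMax_weak ν A c r R hR hpos hfin hdoub F hF _ (by simpa using ht') (by simp)
        _ = _ := by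
            rw [hset, hν', withDensity_apply]
            exact measurableSet_lt measurable_const (hφ.const_mul 2)
    calc _ ≤ A * (2 * (ENNReal.ofReal t)⁻¹ * ν' {a | t < 2 * φ a}) * ENNReal.ofReal (t ^ (p - 1)) := by
          gcongr
      _ = A * 2 * (ν' {a | t < 2 * φ a} * ((ENNReal.ofReal t)⁻¹ * ENNReal.ofReal (t ^ (p - 1)))) := by
          ring
      _ = _ := by
          rw [← ENNReal.ofReal_inv_of_pos ht', ← ENNReal.ofReal_mul (by positivity),
            Real.rpow_sub_one ht'.ne' (p - 1)]
          rw [inv_mul_eq_div]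
  have hI : ∫⁻ x, ENNReal.ofReal ((2 * φ x) ^ (p - 1)) ∂ν' =
      ENNReal.ofReal (2 ^ (p - 1)) * ∫⁻ x, ENNReal.ofReal (φ x ^ p) ∂ν := by
    rw [hν', lintegral_withDensity_eq_lintegral_mul _ hF (by fun_prop),
      ← lintegral_const_mul _ (by fun_prop)]
    refine lintegral_congr fun x => ?_
    simp only [Pi.mul_apply, hFdef]
    rw [← ENNReal.ofReal_mul (hφ0 x), ← ENNReal.ofReal_mul (by positivity),
      Real.mul_rpow (by norm_num) (hφ0 x)]
    congr 1
    have : φ x ^ p = φ x * φ x ^ (p - 1) := by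
      conv_lhs => rw [show p = 1 + (p - 1) by ring]
      rw [Real.rpow_add' (hφ0 x) (by linarith), Real.rpow_one]
    rw [this]; ring
  have hJ : ∫⁻ t in Set.Ioi (0 : ℝ), ν' {a | t < 2 * φ a} * ENNReal.ofReal (t ^ (p - 1 - 1)) =
      ENNReal.ofReal (2 ^ (p - 1) / (p - 1)) * ∫⁻ x, ENNReal.ofReal (φ x ^ p) ∂ν := by
    rw [hI] at hlc
    rw [ENNReal.ofReal_div_of_pos (by linarith), div_eq_mul_inv, mul_right_comm, hlc, mul_right_comm,
      ENNReal.mul_inv_cancel hp1 (by simp), one_mul]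
  rw [hJ] at hle
  calc _ ≤ ENNReal.ofReal p * (A * 2 * (ENNReal.ofReal (2 ^ (p - 1) / (p - 1)) *
        ∫⁻ x, ENNReal.ofReal (φ x ^ p) ∂ν)) := by gcongr
    _ = _ := by ring

/-! ### Cubes are sup-norm balls; consequences of the `A₁` condition -/

lemma isCube_iff {n : ℕ} (Q : Set (Fin n → ℝ)) :
    IsCube Q ↔ ∃ (c : Fin n → ℝ) (r : ℝ), 0 < r ∧ Q = Metric.closedBall c r := by
  constructor
  · rintro ⟨a, h, hh, rfl⟩
    refine ⟨fun i => a i + h / 2, h / 2, by linarith, ?_⟩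
    rw [closedBall_pi _ (by linarith)]
    congr 1
    ext i
    rw [Real.closedBall_eq_Icc]
    ring_nf
  · rintro ⟨c, r, hr, rfl⟩
    refine ⟨fun i => c i - r, 2 * r, by linarith, ?_⟩
    rw [closedBall_pi _ hr.le]
    congr 1
    ext i
    rw [Real.closedBall_eq_Icc]
    ring_nf

lemma vol_cb {n : ℕ} (c : Fin n → ℝ) {r : ℝ} (hr : 0 < r) :
    (volume (Metric.closedBall c r)).toReal = (2 * r) ^ n := by
  rw [Real.volume_pi_closedBall c hr.le, ENNReal.toReal_ofReal (by positivity), Fintype.card_fin]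

/-- Any ball is contained in a comparable ball from a countable family. -/
lemma exists_rational_ball {n : ℕ} (c : Fin n → ℝ) {r : ℝ} (hr : 0 < r) :
    ∃ (k : ℕ) (s : ℚ), r ≤ (s : ℝ) ∧ (s : ℝ) ≤ 2 * r ∧
      Metric.closedBall c r ⊆ Metric.closedBall (TopologicalSpace.denseSeq (Fin n → ℝ) k) s ∧
      Metric.closedBall (TopologicalSpace.denseSeq (Fin n → ℝ) k) s ⊆ Metric.closedBall c (5 * r) := by
  obtain ⟨k, hk⟩ := (TopologicalSpace.denseRange_denseSeq (Fin n → ℝ)).exists_dist_lt c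
    (show 0 < r / 2 by linarith)
  obtain ⟨s, hs1, hs2⟩ := exists_rat_btwn (show 3 * r / 2 < 2 * r by linarith)
  refine ⟨k, s, by linarith, hs2.le, ?_, ?_⟩
  · exact Metric.closedBall_subset_closedBall' (by linarith)
  · exact Metric.closedBall_subset_closedBall' (by rw [dist_comm]; linarith)

/-- The `A₁` condition, with a null set independent of the cube. -/
structure GoodW {n : ℕ} (μ : (Fin n → ℝ) → ℝ) (C : ℝ) : Prop where
  loc : LocallyIntegrable μ
  nonneg : ∀ x, 0 ≤ μ x
  pos : ∀ᵐ x ∂(volume : Measure (Fin n → ℝ)), 0 < μ x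
  one_le : 1 ≤ C
  a1 : ∀ᵐ x ∂(volume : Measure (Fin n → ℝ)), ∀ (c : Fin n → ℝ) (r : ℝ), 0 < r →
    x ∈ Metric.closedBall c r → ∫ y in Metric.closedBall c r, μ y ≤ C * (2 * r) ^ n * μ x

lemma locInt_cb {n : ℕ} {g : (Fin n → ℝ) → ℝ} (hg : LocallyIntegrable g) (c : Fin n → ℝ) (r : ℝ) :
    IntegrableOn g (Metric.closedBall c r) :=
  hg.integrableOn_isCompact (isCompact_closedBall c r)

lemma goodW_of_A1 {n : ℕ} {μ : (Fin n → ℝ) → ℝ} (h : IsA1 μ) : ∃ C, GoodW μ C := by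
  obtain ⟨⟨hloc, hnn, hpos⟩, C, hC, hA⟩ := h
  refine ⟨max 1 (C * 2 ^ n), hloc, hnn, hpos, le_max_left _ _, ?_⟩
  have hall : ∀ᵐ x ∂(volume : Measure (Fin n → ℝ)), ∀ (k : ℕ) (s : ℚ), 0 < (s : ℝ) →
      x ∈ Metric.closedBall (TopologicalSpace.denseSeq (Fin n → ℝ) k) (s : ℝ) →
      ∫ y in Metric.closedBall (TopologicalSpace.denseSeq (Fin n → ℝ) k) (s : ℝ), μ y ≤
        C * (2 * s) ^ n * μ x := by
    rw [ae_all_iff]; intro k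
    rw [ae_all_iff]; intro s
    by_cases hs : 0 < (s : ℝ)
    · have := hA _ ((isCube_iff _).2 ⟨TopologicalSpace.denseSeq (Fin n → ℝ) k, s, hs, rfl⟩)
      rw [ae_restrict_iff' Metric.isClosed_closedBall.measurableSet] at this
      filter_upwards [this] with x hx _ hxm
      have h2 := hx hxm
      unfold cubeAvg at h2
      rw [vol_cb _ hs, inv_mul_le_iff₀ (by positivity)] at h2
      linarith
    · exact Filter.Eventually.of_forall fun x h => absurd h hs
  filter_upwards [hall] with x hx c r hr hxm
  obtain ⟨k, s, hs1, hs2, hsub, -⟩ := exists_rational_ball c hr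
  calc ∫ y in Metric.closedBall c r, μ y ≤
      ∫ y in Metric.closedBall (TopologicalSpace.denseSeq (Fin n → ℝ) k) (s : ℝ), μ y :=
        setIntegral_mono_set (locInt_cb hloc _ _) (Filter.Eventually.of_forall hnn)
          (Filter.Eventually.of_forall hsub)
    _ ≤ C * (2 * s) ^ n * μ x := hx k s (by linarith) (hsub hxm)
    _ ≤ C * (2 * (2 * r)) ^ n * μ x := by
        have := hnn x
        have : 0 ≤ (s : ℝ) := by linarith
        gcongr
    _ = C * 2 ^ n * (2 * r) ^ n * μ x := by rw [mul_pow 2 (2 * r)]; ring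
    _ ≤ _ := by
        have := hnn x
        gcongr
        exact le_max_right _ _

namespace GoodW

variable {n : ℕ} {μ : (Fin n → ℝ) → ℝ} {C : ℝ}

lemma int_pos (h : GoodW μ C) (c : Fin n → ℝ) {r : ℝ} (hr : 0 < r) :
    0 < ∫ y in Metric.closedBall c r, μ y := by
  rw [setIntegral_pos_iff_support_of_nonneg_ae (Filter.Eventually.of_forall h.nonneg)
    (locInt_cb h.loc c r)]
  have : volume (Function.support μ ∩ Metric.closedBall c r) = volume (Metric.closedBall c r) := by
    refine measure_congr ?_
    filter_upwards [h.pos] with x hx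
    apply propext
    change (x ∈ Function.support μ ∩ Metric.closedBall c r) ↔ x ∈ Metric.closedBall c r
    simp [hx.ne']
  rw [this, Real.volume_pi_closedBall c hr.le]
  simp only [ENNReal.ofReal_pos]
  positivity

lemma subset_le (h : GoodW μ C) (c : Fin n → ℝ) {r : ℝ} (hr : 0 < r) {S : Set (Fin n → ℝ)}
    (hS : MeasurableSet S) (hsub : S ⊆ Metric.closedBall c r) :
    (volume S).toReal * ∫ y in Metric.closedBall c r, μ y ≤ C * (2 * r) ^ n * ∫ y in S, μ y := by
  have hfin : volume S < ⊤ := (measure_mono hsub).trans_lt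
    (isCompact_closedBall c r).measure_lt_top
  have h1 : ∫ _ in S, (∫ y in Metric.closedBall c r, μ y) ≤ ∫ x in S, C * (2 * r) ^ n * μ x := by
    refine integral_mono_ae ?_ ?_ ?_
    · exact integrableOn_const hfin.ne
    · exact ((locInt_cb h.loc c r).mono_set hsub).const_mul _
    · rw [Filter.EventuallyLE, ae_restrict_iff' hS]
      filter_upwards [h.a1] with x hx hxS
      exact hx c r hr (hsub hxS)
  rw [integral_const_mul, setIntegral_const, smul_eq_mul] at h1
  exact h1

lemma doubling (h : GoodW μ C) (c : Fin n → ℝ) {r : ℝ} (hr : 0 < r) :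
    ∫ y in Metric.closedBall c (5 * r), μ y ≤ C * 5 ^ n * ∫ y in Metric.closedBall c r, μ y := by
  have h1 := h.subset_le c (show 0 < 5 * r by linarith)
    (Metric.isClosed_closedBall (x := c) (ε := r)).measurableSet
    (Metric.closedBall_subset_closedBall (by linarith))
  rw [vol_cb c hr, show 2 * (5 * r) = 5 * (2 * r) by ring, mul_pow 5] at h1
  have : 0 < (2 * r) ^ n := by positivity
  refine le_of_mul_le_mul_left ?_ this
  linarith

lemma rev_doubling (h : GoodW μ C) (hn : 1 ≤ n) (c c' : Fin n → ℝ) {r : ℝ} (hr : 0 < r)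
    (hsub : Metric.closedBall c' (r / 2) ⊆ Metric.closedBall c r) :
    ∫ y in Metric.closedBall c' (r / 2), μ y ≤
      (1 - 1 / (2 * C)) * ∫ y in Metric.closedBall c r, μ y := by
  have hm : MeasurableSet (Metric.closedBall c' (r / 2)) := Metric.isClosed_closedBall.measurableSet
  have h1 := h.subset_le c hr
    ((Metric.isClosed_closedBall (x := c) (ε := r)).measurableSet.diff hm) Set.sdiff_subset
  have hd := setIntegral_sdiff hm (locInt_cb h.loc c r) hsub
  have hv : (volume (Metric.closedBall c r \ Metric.closedBall c' (r / 2))).toReal =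
      (2 * r) ^ n - (2 * (r / 2)) ^ n := by
    rw [measure_sdiff hsub hm.nullMeasurableSet (isCompact_closedBall _ _).measure_lt_top.ne,
      ENNReal.toReal_sub_of_le (measure_mono hsub) (isCompact_closedBall _ _).measure_lt_top.ne,
      vol_cb c hr, vol_cb c' (by linarith)]
  have hC := h.one_le
  have hp := h.int_pos c hr
  rw [hd, hv] at h1
  have hhalf : (2 * (r / 2)) ^ n ≤ (2 * r) ^ n / 2 := by
    have : (2 * (r / 2)) ^ n = (1 / 2) ^ n * (2 * r) ^ n := by rw [← mul_pow]; ring_nf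
    rw [this]
    have h2 : ((1 : ℝ) / 2) ^ n ≤ (1 / 2) ^ 1 := pow_le_pow_of_le_one (by norm_num) (by norm_num) hn
    have : 0 < (2 * r) ^ n := by positivity
    nlinarith
  have hpw : 0 < (2 * r) ^ n := by positivity
  set M := ∫ y in Metric.closedBall c r, μ y
  set M' := ∫ y in Metric.closedBall c' (r / 2), μ y
  have h3 : (2 * r) ^ n * (M / 2) ≤ (2 * r) ^ n * (C * (M - M')) := by nlinarith
  have h4 := le_of_mul_le_mul_left h3 hpw
  have h5 : M / (2 * C) ≤ M - M' := by
    rw [div_le_iff₀ (by linarith)]; linarith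
  have : (1 - 1 / (2 * C)) * M = M - M / (2 * C) := by ring
  linarith

/-- Pointwise oscillation bound for weighted Lipschitz functions. -/
lemma osc (h : GoodW μ C) (hn : 1 ≤ n) {β : ℝ} (hβ : 0 < β) : ∃ K : ℝ, 0 < K ∧
    ∀ b : (Fin n → ℝ) → ℝ, MemLip β μ b →
      ∀ᵐ x ∂(volume : Measure (Fin n → ℝ)), ∀ (c : Fin n → ℝ) (r : ℝ), 0 < r →
        x ∈ Metric.closedBall c r →
        |b x - cubeAvg (Metric.closedBall c r) b| ≤
          K * lipNorm β μ b * (μ x * (∫ y in Metric.closedBall c r, μ y) ^ (β / n)) := by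
  have hC := h.one_le
  have hn' : (0 : ℝ) < n := by exact_mod_cast hn
  set δ : ℝ := 1 - 1 / (2 * C) with hδ
  have hδ0 : 0 < δ := by
    rw [hδ, sub_pos, div_lt_one (by linarith)]; linarith
  have hδ1 : δ < 1 := by
    have : 0 < 1 / (2 * C) := by positivity
    linarith
  have hβn : 0 < β / n := by positivity
  set θ : ℝ := δ ^ (β / n) with hθ
  have hθ1 : θ < 1 := Real.rpow_lt_one hδ0.le hδ1 hβn
  refine ⟨2 ^ n * C / (1 - θ), div_pos (by positivity) (by linarith), ?_⟩
  intro b hb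
  set L := lipNorm β μ b with hL
  have hLosc : ∀ (c : Fin n → ℝ) (r : ℝ), 0 < r →
      ∫ y in Metric.closedBall c r, |b y - cubeAvg (Metric.closedBall c r) b| ≤
        L * ((∫ y in Metric.closedBall c r, μ y) ^ (β / n) * ∫ y in Metric.closedBall c r, μ y) := by
    intro c r hr
    have hm := h.int_pos c hr
    have : (∫ x in Metric.closedBall c r, μ x) ^ (-(β / (n : ℝ))) *
        (∫ x in Metric.closedBall c r, μ x)⁻¹ *
            ∫ x in Metric.closedBall c r, |b x - cubeAvg (Metric.closedBall c r) b| ≤ L :=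
      le_csSup hb.2 ⟨_, (isCube_iff _).2 ⟨c, r, hr, rfl⟩, rfl⟩
    rw [Real.rpow_neg hm.le, ← mul_inv, inv_mul_le_iff₀ (by positivity)] at this
    linarith
  have hL0 : 0 ≤ L := by
    have h1 := hLosc 0 1 one_pos
    have h2 := h.int_pos 0 one_pos
    have h3 : 0 ≤ ∫ y in Metric.closedBall (0 : Fin n → ℝ) 1,
        |b y - cubeAvg (Metric.closedBall 0 1) b| := integral_nonneg fun y => abs_nonneg _
    exact nonneg_of_mul_nonneg_left (h3.trans h1) (by positivity)
  filter_upwards [h.a1, IsUnifLocDoublingMeasure.ae_tendsto_average.{0, 0, 0} (volume : Measure (Fin n → ℝ))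
    hb.1 1] with x hx hleb c r hr hxm
  set cc : ℕ → (Fin n → ℝ) := fun k => x + (1 / 2 : ℝ) ^ k • (c - x) with hcc
  set rr : ℕ → ℝ := fun k => (1 / 2 : ℝ) ^ k * r with hrr
  have hrr0 : ∀ k, 0 < rr k := fun k => by positivity
  have hrs : ∀ k, rr (k + 1) = rr k / 2 := fun k => by simp only [hrr, pow_succ]; ring
  have hdxc : ‖c - x‖ ≤ r := by
    rw [← dist_eq_norm, dist_comm]; exact hxm
  have hmem : ∀ k, x ∈ Metric.closedBall (cc k) (rr k) := by
    intro k
    rw [Metric.mem_closedBall, dist_comm, dist_eq_norm]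
    simp only [hcc, hrr, add_sub_cancel_left, norm_smul]
    rw [Real.norm_of_nonneg (by positivity)]
    gcongr
  have hnest : ∀ k, Metric.closedBall (cc (k + 1)) (rr (k + 1)) ⊆ Metric.closedBall (cc k) (rr k) := by
    intro k
    apply Metric.closedBall_subset_closedBall'
    have : dist (cc (k + 1)) (cc k) ≤ rr k / 2 := by
      rw [dist_comm, dist_eq_norm]
      have : cc k - cc (k + 1) = ((1 / 2 : ℝ) ^ k / 2) • (c - x) := by
        simp only [hcc, add_sub_add_left_eq_sub, ← sub_smul, pow_succ]
        congr 1; ring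
      rw [this, norm_smul, Real.norm_of_nonneg (by positivity)]
      simp only [hrr]
      have : 0 < (1 / 2 : ℝ) ^ k := by positivity
      nlinarith
    rw [hrs]; linarith
  set m : ℕ → ℝ := fun k => ∫ y in Metric.closedBall (cc k) (rr k), μ y with hm
  have hm0 : ∀ k, 0 < m k := fun k => h.int_pos _ (hrr0 k)
  have hmd : ∀ k, m k ≤ δ ^ k * m 0 := by
    intro k
    induction k with
    | zero => simp
    | succ k ih =>
      have h1 := h.rev_doubling hn (cc k) (cc (k + 1)) (hrr0 k) (by rw [← hrs]; exact hnest k)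
      rw [← hrs] at h1
      calc m (k + 1) ≤ δ * m k := h1
        _ ≤ δ * (δ ^ k * m 0) := by gcongr
        _ = _ := by ring
  set a : ℕ → ℝ := fun k => cubeAvg (Metric.closedBall (cc k) (rr k)) b with ha
  have hlim : Filter.Tendsto a Filter.atTop (nhds (b x)) := by
    have h1 := hleb (l := Filter.atTop) cc rr ?_ ?_
    · refine h1.congr fun k => ?_
      simp only [setAverage_eq, smul_eq_mul]
      rfl
    · rw [tendsto_nhdsWithin_iff]
      refine ⟨?_, Filter.Eventually.of_forall fun k => hrr0 _⟩
      have h3 : Filter.Tendsto rr Filter.atTop (nhds 0) := by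
        have := (tendsto_pow_atTop_nhds_zero_of_lt_one (r := (1 / 2 : ℝ)) (by norm_num)
          (by norm_num)).mul_const r
        rw [zero_mul] at this
        exact this
      exact h3
    · exact Filter.Eventually.of_forall fun k => by rw [one_mul]; exact hmem _
  have hstep : ∀ k, dist (a k) (a (k + 1)) ≤ (2 ^ n * C * L * (μ x * m 0 ^ (β / n))) * θ ^ k := by
    intro k
    set B := Metric.closedBall (cc k) (rr k)
    set B' := Metric.closedBall (cc (k + 1)) (rr (k + 1))
    have hbB : IntegrableOn b B := locInt_cb hb.1 _ _
    have hbB' : IntegrableOn b B' := locInt_cb hb.1 _ _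
    have hv' : (volume B').toReal = (rr k) ^ n := by
      rw [vol_cb _ (hrr0 _), hrs]; congr 1; ring
    have hrn : 0 < (rr k) ^ n := pow_pos (hrr0 k) n
    have hfinB' : volume B' ≠ ⊤ := (isCompact_closedBall _ _).measure_lt_top.ne
    have hfinB : volume B ≠ ⊤ := (isCompact_closedBall _ _).measure_lt_top.ne
    have h1 : a (k + 1) - a k = ((rr k) ^ n)⁻¹ * ∫ y in B', (b y - a k) := by
      rw [integral_sub hbB' (integrableOn_const hfinB'), setIntegral_const, smul_eq_mul]
      change (volume B').toReal⁻¹ * (∫ y in B', b y) - a k = _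
      rw [measureReal_def, hv']
      field_simp
    have h2 : |∫ y in B', (b y - a k)| ≤ ∫ y in B, |b y - a k| := by
      calc |∫ y in B', (b y - a k)| ≤ ∫ y in B', |b y - a k| := abs_integral_le_integral_abs
        _ ≤ _ := setIntegral_mono_set (hbB.sub (integrableOn_const hfinB)).abs
            (Filter.Eventually.of_forall fun y => abs_nonneg _)
            (Filter.Eventually.of_forall (hnest k))
    have h3 := hLosc (cc k) (rr k) (hrr0 k)
    have h4 := hx (cc k) (rr k) (hrr0 k) (hmem k)
    have h5 : m k ^ (β / n) ≤ θ ^ k * m 0 ^ (β / n) := by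
      calc m k ^ (β / n) ≤ (δ ^ k * m 0) ^ (β / n) :=
            Real.rpow_le_rpow (hm0 k).le (hmd k) hβn.le
        _ = _ := by
            rw [Real.mul_rpow (by positivity) (hm0 0).le, hθ, ← Real.rpow_natCast,
              ← Real.rpow_natCast, ← Real.rpow_mul hδ0.le, ← Real.rpow_mul hδ0.le, mul_comm (k : ℝ)]
    rw [dist_comm, Real.dist_eq, h1, abs_mul, abs_of_pos (by positivity)]
    have hmk : 0 < m k ^ (β / n) := Real.rpow_pos_of_pos (hm0 k) _
    have hμx := h.nonneg x
    calc ((rr k) ^ n)⁻¹ * |∫ y in B', (b y - a k)|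
        ≤ ((rr k) ^ n)⁻¹ * (L * (m k ^ (β / n) * m k)) := by
          gcongr; exact h2.trans h3
      _ ≤ ((rr k) ^ n)⁻¹ * (L * (m k ^ (β / n) * (C * (2 * rr k) ^ n * μ x))) := by gcongr
      _ = 2 ^ n * C * L * μ x * m k ^ (β / n) := by
          rw [mul_pow 2 (rr k)]
          generalize (rr k) ^ n = w at hrn
          field_simp
      _ ≤ 2 ^ n * C * L * μ x * (θ ^ k * m 0 ^ (β / n)) := by gcongr
      _ = _ := by ring
  have hfinal := dist_le_of_le_geometric_of_tendsto₀ θ _ hθ1 hstep hlim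
  have hcc0 : cc 0 = c := by simp [hcc]
  have hrr0' : rr 0 = r := by simp [hrr]
  rw [dist_comm, Real.dist_eq] at hfinal
  simp only [ha, hm, hcc0, hrr0'] at hfinal
  calc _ ≤ _ := hfinal
    _ = _ := by ring

end GoodW

/-! ### Hölder and the pointwise bound -/

lemma holder_gen {α : Type*} [MeasurableSpace α] (ρ : Measure α) (g w : α → ℝ)
    (hg0 : ∀ x, 0 ≤ g x) (hw0 : ∀ x, 0 ≤ w x) (hg : Integrable g ρ) (hw : Integrable w ρ)
    {p : ℝ} (hp : 1 < p) :
    Integrable (fun x => g x ^ (1 / p) * w x ^ (1 - 1 / p)) ρ ∧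
    ∫ x, g x ^ (1 / p) * w x ^ (1 - 1 / p) ∂ρ ≤ (∫ x, g x ∂ρ) ^ (1 / p) * (∫ x, w x ∂ρ) ^ (1 - 1 / p) := by
  have hpq : p.HolderConjugate (p.conjExponent) := Real.HolderConjugate.conjExponent hp
  set p' := p.conjExponent
  have hp'1 : 1 - 1 / p = 1 / p' := by
    have := hpq.inv_add_inv_eq_one
    simp only [one_div]; linarith
  have hp'0 : 0 < p' := hpq.symm.pos
  have hp0 : 0 < p := hpq.pos
  have aux : ∀ (s : ℝ), 0 < s → ∀ (h : α → ℝ), (∀ x, 0 ≤ h x) → Integrable h ρ →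
      MemLp (fun x => h x ^ (1 / s)) (ENNReal.ofReal s) ρ := by
    intro s hs h h0 hi
    rw [← integrable_norm_rpow_iff (hi.aemeasurable.pow_const _).aestronglyMeasurable
      (by simpa using hs) (by simp), ENNReal.toReal_ofReal hs.le]
    refine hi.congr (Filter.Eventually.of_forall fun x => ?_)
    simp only []
    rw [Real.norm_of_nonneg (Real.rpow_nonneg (h0 x) _), ← Real.rpow_mul (h0 x),
      one_div_mul_cancel hs.ne', Real.rpow_one]
  have h1 := aux p hp0 g hg0 hg
  have h2 := aux p' hp'0 w hw0 hw
  rw [hp'1]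
  constructor
  · have : (ENNReal.ofReal p).HolderTriple (ENNReal.ofReal p') 1 := hpq.ennrealOfReal
    exact h1.integrable_mul h2
  · have h3 := integral_mul_le_Lp_mul_Lq_of_nonneg hpq
      (Filter.Eventually.of_forall fun x => Real.rpow_nonneg (hg0 x) (1 / p))
      (Filter.Eventually.of_forall fun x => Real.rpow_nonneg (hw0 x) (1 / p')) h1 h2
    have e1 : ∀ x, (g x ^ (1 / p)) ^ p = g x := fun x => by
      rw [← Real.rpow_mul (hg0 x), one_div_mul_cancel hp0.ne', Real.rpow_one]
    have e2 : ∀ x, (w x ^ (1 / p')) ^ p' = w x := fun x => by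
      rw [← Real.rpow_mul (hw0 x), one_div_mul_cancel hp'0.ne', Real.rpow_one]
    simp only [e1, e2] at h3
    exact h3

namespace GoodW

variable {n : ℕ} {μ : (Fin n → ℝ) → ℝ} {C : ℝ}

lemma f_holder (h : GoodW μ C) {p : ℝ} (hp : 1 < p) {f : (Fin n → ℝ) → ℝ} (S : Set (Fin n → ℝ))
    (hf : IntegrableOn (fun x => |f x| ^ p * μ x) S) (hμ : IntegrableOn μ S) :
    IntegrableOn (fun x => |f x| * μ x) S ∧
    ∫ x in S, |f x| * μ x ≤ (∫ x in S, |f x| ^ p * μ x) ^ (1 / p) * (∫ x in S, μ x) ^ (1 - 1 / p) := by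
  have hp0 : 0 < p := by linarith
  have := holder_gen (volume.restrict S) (fun x => |f x| ^ p * μ x) μ
    (fun x => mul_nonneg (by positivity) (h.nonneg x)) h.nonneg hf hμ hp
  have e : ∀ x, (|f x| ^ p * μ x) ^ (1 / p) * μ x ^ (1 - 1 / p) = |f x| * μ x := by
    intro x
    rw [Real.mul_rpow (by positivity) (h.nonneg x), ← Real.rpow_mul (abs_nonneg _),
      mul_one_div_cancel hp0.ne', Real.rpow_one, mul_assoc, ← Real.rpow_add' (h.nonneg x) (by simp)]
    simp
  simp only [e] at this
  exact this

lemma lip_nonneg (h : GoodW μ C) (β : ℝ) (b : (Fin n → ℝ) → ℝ) : 0 ≤ lipNorm β μ b := by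
  apply Real.sSup_nonneg
  rintro x ⟨Q, hQ, rfl⟩
  have h1 : 0 ≤ ∫ x in Q, μ x := integral_nonneg h.nonneg
  have h2 : 0 ≤ ∫ x in Q, |b x - cubeAvg Q b| := integral_nonneg fun _ => abs_nonneg _
  positivity

lemma pointwise (h : GoodW μ C) (hn : 1 ≤ n) {β : ℝ} (hβ : 0 < β) : ∃ K : ℝ, 0 < K ∧
    ∀ b : (Fin n → ℝ) → ℝ, MemLip β μ b → ∀ f : (Fin n → ℝ) → ℝ,
      (∀ c r, IntegrableOn (fun x => |f x| * μ x) (Metric.closedBall c r)) →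
      ∀ᵐ x ∂(volume : Measure (Fin n → ℝ)), ∀ (c : Fin n → ℝ) (r : ℝ), 0 < r →
        x ∈ Metric.closedBall c r →
        (volume (Metric.closedBall c r)).toReal⁻¹ *
          ∫ y in Metric.closedBall c r, |b x - b y| * |f y| ≤
          K * lipNorm β μ b * μ x * ((∫ y in Metric.closedBall c r, μ y) ^ (β / n - 1) *
            ∫ y in Metric.closedBall c r, |f y| * μ y) := by
  obtain ⟨K, hK, hosc⟩ := h.osc hn hβ
  have hC : 0 < C := by linarith [h.one_le]
  refine ⟨2 * K * C, by positivity, ?_⟩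
  intro b hb f hf
  have hL := h.lip_nonneg β b
  set L := lipNorm β μ b
  have hae := (hosc b hb).and h.a1
  filter_upwards [hae] with x ⟨hx1, hx2⟩ c r hr hxm
  set B := Metric.closedBall c r with hB
  set m := ∫ y in B, μ y with hm
  have hm0 : 0 < m := h.int_pos c hr
  have hV : (volume B).toReal = (2 * r) ^ n := vol_cb c hr
  have hV0 : 0 < (2 * r) ^ n := by positivity
  have hmb : 0 < m ^ (β / n) := Real.rpow_pos_of_pos hm0 _
  have hμx := h.nonneg x
  have hle : ∫ y in B, |b x - b y| * |f y| ≤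
      ∫ y in B, (2 * K * C * L * μ x * (2 * r) ^ n * (m ^ (β / n) / m)) * (|f y| * μ y) := by
    refine integral_mono_of_nonneg (Filter.Eventually.of_forall fun y => by positivity)
      ((hf c r).const_mul _) ?_
    rw [Filter.EventuallyLE, ae_restrict_iff' Metric.isClosed_closedBall.measurableSet]
    filter_upwards [hae] with y ⟨hy1, hy2⟩ hyB
    have a1 := hx1 c r hr hxm
    have a2 := hy1 c r hr hyB
    have a3 := hx2 c r hr hxm
    have a4 := hy2 c r hr hyB
    have hμy := h.nonneg y
    have a5 : |b x - b y| ≤ K * L * m ^ (β / n) * (μ x + μ y) := by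
      have := abs_sub_le (b x) (cubeAvg B b) (b y)
      rw [abs_sub_comm (cubeAvg B b) (b y)] at this
      calc _ ≤ _ := this
        _ ≤ _ := add_le_add a1 a2
        _ = _ := by ring
    have a6 : μ x + μ y ≤ 2 * C * (2 * r) ^ n * μ x * μ y / m := by
      rw [le_div_iff₀ hm0]
      have b1 := mul_le_mul_of_nonneg_left a3 hμy
      have b2 := mul_le_mul_of_nonneg_left a4 hμx
      calc (μ x + μ y) * m = μ y * m + μ x * m := by ring
        _ ≤ _ := add_le_add b1 b2
        _ = _ := by ring
    calc |b x - b y| * |f y| ≤ (K * L * m ^ (β / n) * (μ x + μ y)) * |f y| := by gcongr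
      _ ≤ (K * L * m ^ (β / n) * (2 * C * (2 * r) ^ n * μ x * μ y / m)) * |f y| := by gcongr
      _ = _ := by ring
  rw [integral_const_mul] at hle
  rw [hV, inv_mul_le_iff₀ hV0, Real.rpow_sub_one hm0.ne']
  calc _ ≤ _ := hle
    _ = _ := by ring

/-! ### The local maximal function with respect to the weighted measure -/

lemma aem (h : GoodW μ C) : AEMeasurable (fun x => ENNReal.ofReal (μ x)) :=
  h.loc.aestronglyMeasurable.aemeasurable.ennreal_ofReal

lemma lint (h : GoodW μ C) {S : Set (Fin n → ℝ)} (hS : MeasurableSet S) {g : (Fin n → ℝ) → ℝ}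
    (hg : Measurable g) :
    ∫⁻ x in S, ENNReal.ofReal (g x) ∂(volume.withDensity fun x => ENNReal.ofReal (μ x)) =
      ∫⁻ x in S, ENNReal.ofReal (g x * μ x) := by
  rw [restrict_withDensity hS, lintegral_withDensity_eq_lintegral_mul₀ h.aem.restrict
    (by fun_prop)]
  refine lintegral_congr fun x => ?_
  rw [Pi.mul_apply, mul_comm, ENNReal.ofReal_mul' (h.nonneg x)]

lemma maxfun (h : GoodW μ C) {p : ℝ} (hp : 1 < p) : ∃ K : ℝ, 0 < K ∧
    ∀ f : (Fin n → ℝ) → ℝ,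
      (∀ c r, 0 < r → IntegrableOn (fun x => |f x| ^ p * μ x) (Metric.closedBall c r)) →
      ∀ (c₀ : Fin n → ℝ) (r₀ : ℝ), 0 < r₀ → ∃ Ψ : (Fin n → ℝ) → ℝ, Measurable Ψ ∧ (∀ x, 0 ≤ Ψ x) ∧
        ∫⁻ x, ENNReal.ofReal (Ψ x ^ p * μ x) ≤
          ENNReal.ofReal (K * ∫ x in Metric.closedBall c₀ (5 * r₀), |f x| ^ p * μ x) ∧
        ∀ᵐ x ∂(volume : Measure (Fin n → ℝ)), x ∈ Metric.closedBall c₀ r₀ →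
          ∀ (c : Fin n → ℝ) (r : ℝ), 0 < r → r ≤ r₀ → x ∈ Metric.closedBall c r →
            ∫ y in Metric.closedBall c r, |f y| * μ y ≤
              C * 5 ^ n * (∫ y in Metric.closedBall c r, μ y) * Ψ x := by
  have hC := h.one_le
  set D : ℝ := C * 5 ^ n with hD
  have hD0 : 0 < D := by positivity
  have hp1 : 0 < p - 1 := by linarith
  refine ⟨p * D * 2 * (2 ^ (p - 1) / (p - 1)), by positivity, ?_⟩
  intro f hf c₀ r₀ hr₀
  set ν : Measure (Fin n → ℝ) := volume.withDensity fun x => ENNReal.ofReal (μ x) with hν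
  set Q5 := Metric.closedBall c₀ (5 * r₀) with hQ5
  have hQ5m : MeasurableSet Q5 := Metric.isClosed_closedBall.measurableSet
  have hνB : ∀ c r, ν (Metric.closedBall c r) =
      ENNReal.ofReal (∫ y in Metric.closedBall c r, μ y) := by
    intro c r
    rw [hν, withDensity_apply _ Metric.isClosed_closedBall.measurableSet,
      ofReal_integral_eq_lintegral_ofReal (locInt_cb h.loc c r) (Filter.Eventually.of_forall h.nonneg)]
  have hJint : IntegrableOn (fun x => |f x| ^ p * μ x) Q5 := hf c₀ _ (by linarith)
  have hIint := (h.f_holder hp Q5 hJint (locInt_cb h.loc _ _)).1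
  -- measurable representative of `|f|`
  have hfm : AEMeasurable (fun x => |f x|) (volume.restrict Q5) := by
    have h1 : AEMeasurable (fun x => ((|f x| ^ p * μ x) / μ x) ^ (1 / p)) (volume.restrict Q5) :=
      (hJint.aemeasurable.div (locInt_cb h.loc c₀ (5 * r₀)).aemeasurable).pow_const _
    refine h1.congr ?_
    filter_upwards [ae_restrict_of_ae h.pos] with x hx
    rw [mul_div_cancel_right₀ _ hx.ne', ← Real.rpow_mul (abs_nonneg _),
      mul_one_div_cancel (by linarith), Real.rpow_one]
  set φ : (Fin n → ℝ) → ℝ := Q5.indicator (fun x => |hfm.mk _ x|) with hφdef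
  have hφm : Measurable φ := (hfm.measurable_mk.abs).indicator hQ5m
  have hφ0 : ∀ x, 0 ≤ φ x := fun x => Set.indicator_nonneg (fun _ _ => abs_nonneg _) x
  have hφf : ∀ᵐ x ∂(volume : Measure (Fin n → ℝ)), x ∈ Q5 → φ x = |f x| := by
    have := hfm.ae_eq_mk
    rw [Filter.EventuallyEq, ae_restrict_iff' hQ5m] at this
    filter_upwards [this] with x hx hxQ
    rw [hφdef, Set.indicator_of_mem hxQ, ← hx hxQ, abs_abs]
  have hφout : ∀ x, x ∉ Q5 → φ x = 0 := fun x hx => Set.indicator_of_notMem hx _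
  have hI1 : ∫⁻ x, ENNReal.ofReal (φ x) ∂ν = ENNReal.ofReal (∫ x in Q5, |f x| * μ x) := by
    have := h.lint MeasurableSet.univ hφm
    rw [Measure.restrict_univ, Measure.restrict_univ] at this
    rw [this, ofReal_integral_eq_lintegral_ofReal hIint
      (Filter.Eventually.of_forall fun x => mul_nonneg (abs_nonneg _) (h.nonneg x)),
      ← lintegral_indicator hQ5m]
    refine lintegral_congr_ae ?_
    filter_upwards [hφf] with x hx
    by_cases hxQ : x ∈ Q5
    · rw [Set.indicator_of_mem hxQ, hx hxQ]
    · rw [Set.indicator_of_notMem hxQ, hφout x hxQ]; simp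
  have hIp : ∫⁻ x, ENNReal.ofReal (φ x ^ p) ∂ν = ENNReal.ofReal (∫ x in Q5, |f x| ^ p * μ x) := by
    have := h.lint MeasurableSet.univ (hφm.pow_const p)
    rw [Measure.restrict_univ, Measure.restrict_univ] at this
    rw [this, ofReal_integral_eq_lintegral_ofReal hJint
      (Filter.Eventually.of_forall fun x => mul_nonneg (by positivity) (h.nonneg x)),
      ← lintegral_indicator hQ5m]
    refine lintegral_congr_ae ?_
    filter_upwards [hφf] with x hx
    by_cases hxQ : x ∈ Q5
    · rw [Set.indicator_of_mem hxQ, hx hxQ]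
    · rw [Set.indicator_of_notMem hxQ, hφout x hxQ, Real.zero_rpow (by linarith)]; simp
  -- the countable family
  let ι := {k : ℕ × ℚ // 0 < (k.2 : ℝ) ∧ (k.2 : ℝ) ≤ 2 * r₀}
  let cc : ι → (Fin n → ℝ) := fun k => TopologicalSpace.denseSeq (Fin n → ℝ) k.1.1
  let rr : ι → ℝ := fun k => (k.1.2 : ℝ)
  have hrr0 : ∀ i, 0 < rr i := fun i => i.2.1
  have hpos : ∀ i, ν (Metric.closedBall (cc i) (rr i)) ≠ 0 := fun i => by
    rw [hνB]; simpa using h.int_pos (cc i) (hrr0 i)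
  have hfin : ∀ i, ν (Metric.closedBall (cc i) (rr i)) ≠ ⊤ := fun i => by
    rw [hνB]; simp
  have hdoub : ∀ i, ν (Metric.closedBall (cc i) (5 * rr i)) ≤
      ENNReal.ofReal D * ν (Metric.closedBall (cc i) (rr i)) := fun i => by
    rw [hνB, hνB, ← ENNReal.ofReal_mul hD0.le]
    exact ENNReal.ofReal_le_ofReal (h.doubling (cc i) (hrr0 i))
  have hIfin : ∫⁻ x, ENNReal.ofReal (φ x) ∂ν ≠ ⊤ := by rw [hI1]; simp
  set MF := famMax ν cc rr (fun x => ENNReal.ofReal (φ x)) with hMF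
  have hMm : Measurable MF := famMax_measurable ν cc rr _
  have hstrong := famMax_strong ν (ENNReal.ofReal D) (by simp) cc rr (2 * r₀) (fun i => i.2.2)
    hpos hfin hdoub φ hφm hφ0 hIfin p hp
  have hfinite := famMax_finite ν (ENNReal.ofReal D) (by simp) cc rr (2 * r₀) (fun i => i.2.2)
    hpos hfin hdoub _ hφm.ennreal_ofReal hIfin
  have hac : (volume : Measure (Fin n → ℝ)) ≪ ν := by
    refine withDensity_absolutelyContinuous' h.aem ?_
    filter_upwards [h.pos] with x hx
    simpa using hx
  refine ⟨fun x => (MF x).toReal, hMm.ennreal_toReal, fun x => ENNReal.toReal_nonneg, ?_, ?_⟩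
  · have := h.lint MeasurableSet.univ (hMm.ennreal_toReal.pow_const p)
    rw [Measure.restrict_univ, Measure.restrict_univ] at this
    rw [← this]
    refine hstrong.trans (le_of_eq ?_)
    rw [hIp]
    have hD0 : 0 ≤ D := by positivity
    clear_value D
    rw [ENNReal.ofReal_mul (p := p * D * 2 * (2 ^ (p - 1) / (p - 1))) (by positivity),
      ENNReal.ofReal_mul (p := p * D * 2) (by positivity),
      ENNReal.ofReal_mul (p := p * D) (by positivity),
      ENNReal.ofReal_mul (p := p) (q := D) (by linarith)]
    simp
  · filter_upwards [hac.ae_le hfinite] with x hxfin hxQ c r hr hrr₀ hxm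
    obtain ⟨k, s, hs1, hs2, hsub1, hsub2⟩ := exists_rational_ball c hr
    let i : ι := ⟨(k, s), by change 0 < (s : ℝ); linarith, by change (s : ℝ) ≤ _; linarith⟩
    have hBQ : Metric.closedBall c r ⊆ Q5 := by
      apply Metric.closedBall_subset_closedBall'
      have := dist_triangle c x c₀
      rw [dist_comm c x] at this
      have h1 : dist x c ≤ r := hxm
      have h2 : dist x c₀ ≤ r₀ := hxQ
      linarith
    have hBi : Metric.closedBall (cc i) (rr i) =
      Metric.closedBall (TopologicalSpace.denseSeq (Fin n → ℝ) k) (s : ℝ) := rfl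
    have hle : (ν (Metric.closedBall (cc i) (rr i)))⁻¹ *
        ∫⁻ y in Metric.closedBall (cc i) (rr i), ENNReal.ofReal (φ y) ∂ν ≤ MF x := by
      have := le_iSup (fun i => (Metric.closedBall (cc i) (rr i)).indicator
        (fun _ => (ν (Metric.closedBall (cc i) (rr i)))⁻¹ *
          ∫⁻ y in Metric.closedBall (cc i) (rr i), ENNReal.ofReal (φ y) ∂ν) x) i
      rw [Set.indicator_of_mem (hsub1 hxm)] at this
      exact this
    have hle2 : ∫⁻ y in Metric.closedBall (cc i) (rr i), ENNReal.ofReal (φ y) ∂ν ≤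
        ν (Metric.closedBall (cc i) (rr i)) * MF x := by
      calc _ = ν (Metric.closedBall (cc i) (rr i)) * ((ν (Metric.closedBall (cc i) (rr i)))⁻¹ *
        ∫⁻ y in Metric.closedBall (cc i) (rr i), ENNReal.ofReal (φ y) ∂ν) := by
            rw [← mul_assoc, ENNReal.mul_inv_cancel (hpos i) (hfin i), one_mul]
        _ ≤ _ := by gcongr
    have hIB : ENNReal.ofReal (∫ y in Metric.closedBall c r, |f y| * μ y) =
        ∫⁻ y in Metric.closedBall c r, ENNReal.ofReal (φ y) ∂ν := by
      rw [h.lint Metric.isClosed_closedBall.measurableSet hφm,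
        ofReal_integral_eq_lintegral_ofReal (hIint.mono_set hBQ)
        (Filter.Eventually.of_forall fun x => mul_nonneg (abs_nonneg _) (h.nonneg x))]
      refine setLIntegral_congr_fun_ae Metric.isClosed_closedBall.measurableSet ?_
      filter_upwards [hφf] with y hy hyB
      rw [hy (hBQ hyB)]
    have hm0 := h.int_pos c hr
    have hfinal : ENNReal.ofReal (∫ y in Metric.closedBall c r, |f y| * μ y) ≤
        ENNReal.ofReal (D * (∫ y in Metric.closedBall c r, μ y) * (MF x).toReal) := by
      rw [ENNReal.ofReal_mul (by positivity), ENNReal.ofReal_toReal hxfin.ne, hIB]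
      calc _ ≤ ∫⁻ y in Metric.closedBall (cc i) (rr i), ENNReal.ofReal (φ y) ∂ν :=
            lintegral_mono_set hsub1
        _ ≤ _ := hle2
        _ ≤ _ := by
            gcongr
            calc ν (Metric.closedBall (cc i) (rr i)) ≤ ν (Metric.closedBall c (5 * r)) :=
                  measure_mono hsub2
              _ ≤ _ := by
                  rw [hνB]
                  exact ENNReal.ofReal_le_ofReal (h.doubling c hr)
    exact (ENNReal.ofReal_le_ofReal_iff (by positivity)).1 hfinal

end GoodW

/-! ### Assembly -/

lemma integral_le_of_lintegral {α : Type*} [MeasurableSpace α] {ρ : Measure α} {g k : α → ℝ} {S : ℝ}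
    (hS : 0 ≤ S) (hg : 0 ≤ᵐ[ρ] g) (hgk : g ≤ᵐ[ρ] k)
    (hk : ∫⁻ x, ENNReal.ofReal (k x) ∂ρ ≤ ENNReal.ofReal S) : ∫ x, g x ∂ρ ≤ S := by
  by_cases hm : AEStronglyMeasurable g ρ
  · rw [integral_eq_lintegral_of_nonneg_ae hg hm]
    refine ENNReal.toReal_le_of_le_ofReal hS (le_trans ?_ hk)
    exact lintegral_mono_ae (hgk.mono fun x hx => ENNReal.ofReal_le_ofReal hx)
  · rw [integral_non_aestronglyMeasurable hm]; exact hS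

/-- The Hedberg-type exponent computation. -/
lemma hedberg {m I D P J p q s : ℝ} (hm : 0 < m) (hI : 0 ≤ I) (hD : 0 ≤ D) (hP : 0 ≤ P) (hJ : 0 ≤ J)
    (hp : 1 < p) (hq : 0 < q) (hpq : 1 / q = 1 / p - s) (hs : 0 < s)
    (h1 : I ≤ D * m * P) (h2 : I ≤ J ^ (1 / p) * m ^ (1 - 1 / p)) :
    m ^ (s - 1) * I ≤ (D * P) ^ (p / q) * J ^ s := by
  have hp0 : 0 < p := by linarith
  have hpq1 : p / q = 1 - p * s := by
    have : p / q = p * (1 / q) := by ring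
    rw [this, hpq]; field_simp
  have hpq0 : 0 < p / q := by positivity
  have e1 : I = I ^ (p / q) * I ^ (p * s) := by
    rw [← Real.rpow_add' hI (by rw [hpq1]; simp), hpq1]; simp
  have hps : 0 < p * s := by positivity
  have k1 : I ^ (p / q) ≤ (D * P) ^ (p / q) * m ^ (p / q) := by
    rw [← Real.mul_rpow (by positivity) hm.le]
    exact Real.rpow_le_rpow hI (by linarith) hpq0.le
  have k2 : I ^ (p * s) ≤ J ^ s * m ^ ((p - 1) * s) := by
    have := Real.rpow_le_rpow hI h2 hps.le
    rw [Real.mul_rpow (by positivity) (by positivity), ← Real.rpow_mul hJ, ← Real.rpow_mul hm.le] at this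
    rwa [show 1 / p * (p * s) = s by field_simp,
      show (1 - 1 / p) * (p * s) = (p - 1) * s by field_simp] at this
  calc m ^ (s - 1) * I = m ^ (s - 1) * (I ^ (p / q) * I ^ (p * s)) := by rw [← e1]
    _ ≤ m ^ (s - 1) * (((D * P) ^ (p / q) * m ^ (p / q)) * (J ^ s * m ^ ((p - 1) * s))) := by
        have := Real.rpow_nonneg hm.le (s - 1)
        gcongr
    _ = (D * P) ^ (p / q) * J ^ s * (m ^ (s - 1) * m ^ (p / q) * m ^ ((p - 1) * s)) := by ring
    _ = _ := by
        rw [← Real.rpow_add hm, ← Real.rpow_add hm, hpq1,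
          show s - 1 + (1 - p * s) + (p - 1) * s = 0 by ring]
        simp

set_option maxHeartbeats 2000000 in
lemma GoodW.main {n : ℕ} {μ : (Fin n → ℝ) → ℝ} {C : ℝ} (h : GoodW μ C) (hn : 1 ≤ n)
    {β p q κ : ℝ} (hβ0 : 0 < β)
    (hp1 : 1 < p) (hpn : p < n / β)
    (hq : 1 / q = 1 / p - β / n) (hκ0 : 0 < κ) (hκ : κ < p / q) :
    ∃ C > 0, ∀ b : (Fin n → ℝ) → ℝ, MemLip β μ b →
      ∀ f : (Fin n → ℝ) → ℝ, MemMorrey p κ μ f →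
        morreyNorm2 q (κ * q / p) (fun x => μ x ^ (1 - q)) μ (maxCommutator b f) ≤
          C * lipNorm β μ b * morreyNorm p κ μ f := by
  have hn' : (0 : ℝ) < n := by exact_mod_cast hn
  have hp0 : 0 < p := by linarith
  set s : ℝ := β / n with hs
  have hs0 : 0 < s := by positivity
  have hq1 : 0 < 1 / q := by
    rw [hq, sub_pos, hs, div_lt_div_iff₀ hn' hp0]
    rw [lt_div_iff₀ hβ0] at hpn
    linarith
  have hq0 : 0 < q := by simpa using hq1
  have hqp : q * s + 1 = q / p := by
    have : s = 1 / p - 1 / q := by linarith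
    rw [this]; field_simp; ring
  have hC := h.one_le
  set D : ℝ := C * 5 ^ n with hD
  have hD0 : 0 < D := by positivity
  obtain ⟨K₁, hK₁, hpt⟩ := h.pointwise hn hβ0
  obtain ⟨K₂, hK₂, hmax⟩ := h.maxfun hp1
  set W : ℝ := D ^ p * K₂ * D ^ (κ * q / p) + D ^ (1 - κ * q / p) with hW
  have hW0 : 0 < W := by positivity
  refine ⟨K₁ * W ^ (1 / q), by positivity, ?_⟩
  intro b hb f hf
  have hL := h.lip_nonneg β b
  set L := lipNorm β μ b
  set N := morreyNorm p κ μ f with hN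
  have hfi : ∀ c r, 0 < r → IntegrableOn (fun x => |f x| ^ p * μ x) (Metric.closedBall c r) :=
    fun c r hr => hf.1 _ ((isCube_iff _).2 ⟨c, r, hr, rfl⟩)
  have hfi1 : ∀ c r, IntegrableOn (fun x => |f x| * μ x) (Metric.closedBall c r) := by
    intro c r
    rcases lt_or_ge 0 r with hr | hr
    · exact (h.f_holder hp1 _ (hfi c r hr) (locInt_cb h.loc _ _)).1
    · refine IntegrableOn.mono_set
        (h.f_holder hp1 _ (hfi c 1 one_pos) (locInt_cb h.loc _ _)).1 ?_
      exact Metric.closedBall_subset_closedBall (by linarith)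
  have hI0 : ∀ S : Set (Fin n → ℝ), 0 ≤ ∫ x in S, |f x| * μ x := fun S =>
    integral_nonneg fun x => mul_nonneg (abs_nonneg _) (h.nonneg x)
  have hJ0 : ∀ S : Set (Fin n → ℝ), 0 ≤ ∫ x in S, |f x| ^ p * μ x := fun S =>
    integral_nonneg fun x => mul_nonneg (by positivity) (h.nonneg x)
  have hN0 : 0 ≤ N := by
    apply Real.sSup_nonneg
    rintro x ⟨Q, hQ, rfl⟩
    have h1 : 0 ≤ ∫ x in Q, μ x := integral_nonneg h.nonneg
    have h2 := hJ0 Q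
    positivity
  have hJN : ∀ c r, 0 < r → ∫ x in Metric.closedBall c r, |f x| ^ p * μ x ≤
      (∫ x in Metric.closedBall c r, μ x) ^ κ * N ^ p := by
    intro c r hr
    have hm := h.int_pos c hr
    have hJ := hJ0 (Metric.closedBall c r)
    have h1 : ((∫ x in Metric.closedBall c r, μ x) ^ (-κ) *
        ∫ x in Metric.closedBall c r, |f x| ^ p * μ x) ^ (1 / p) ≤ N :=
      le_csSup hf.2 ⟨_, (isCube_iff _).2 ⟨c, r, hr, rfl⟩, rfl⟩
    have h2 := Real.rpow_le_rpow (by positivity) h1 hp0.le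
    rw [← Real.rpow_mul (by positivity), one_div_mul_cancel hp0.ne', Real.rpow_one,
      Real.rpow_neg hm.le, inv_mul_le_iff₀ (by positivity)] at h2
    exact h2
  unfold morreyNorm2
  refine Real.sSup_le ?_ (by positivity)
  rintro _ ⟨Q, hQ, rfl⟩
  obtain ⟨c₀, r₀, hr₀, rfl⟩ := (isCube_iff Q).1 hQ
  set Q := Metric.closedBall c₀ r₀ with hQdef
  have hQm : MeasurableSet Q := Metric.isClosed_closedBall.measurableSet
  set mQ := ∫ x in Q, μ x with hmQ
  have hmQ0 : 0 < mQ := h.int_pos c₀ hr₀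
  set J := ∫ x in Metric.closedBall c₀ (5 * r₀), |f x| ^ p * μ x with hJ
  have hJnn : 0 ≤ J := hJ0 _
  obtain ⟨Ψ, hΨm, hΨ0, hΨint, hΨ⟩ := hmax f hfi c₀ r₀ hr₀
  set e : ℝ := 1 / q - κ / p with he
  have he0 : 0 < e := by
    rw [he, sub_pos, div_lt_div_iff₀ hp0 hq0]
    rw [lt_div_iff₀ hq0] at hκ
    linarith
  set T : ℝ := (mQ / D) ^ (-e) * N with hT
  have hT0 : 0 ≤ T := by positivity
  -- the bound for the commutator
  have hbound : ∀ᵐ x ∂(volume : Measure (Fin n → ℝ)), x ∈ Q →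
      0 ≤ maxCommutator b f x ∧
      maxCommutator b f x ≤ K₁ * L * μ x * max ((D * Ψ x) ^ (p / q) * J ^ s) T := by
    filter_upwards [hpt b hb f hfi1, hΨ] with x hx1 hx2 hxQ
    have hμx := h.nonneg x
    have hmx0 : 0 ≤ max ((D * Ψ x) ^ (p / q) * J ^ s) T := le_max_of_le_right hT0
    constructor
    · apply Real.sSup_nonneg
      rintro _ ⟨B, -, -, rfl⟩
      have : 0 ≤ ∫ y in B, |b x - b y| * |f y| := integral_nonneg fun y => by positivity
      positivity
    · refine Real.sSup_le ?_ (by positivity)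
      rintro _ ⟨B, hB, hxB, rfl⟩
      obtain ⟨c, r, hr, rfl⟩ := (isCube_iff B).1 hB
      refine (hx1 c r hr hxB).trans ?_
      gcongr
      set m := ∫ y in Metric.closedBall c r, μ y with hm
      have hm0 : 0 < m := h.int_pos c hr
      have hh := (h.f_holder hp1 _ (hfi c r hr) (locInt_cb h.loc c r)).2
      rcases le_or_gt r r₀ with hrr | hrr
      · refine le_max_of_le_left ?_
        refine hedberg hm0 (hI0 _) hD0.le (hΨ0 x) hJnn hp1 hq0 hq hs0 (hx2 hxQ c r hr hrr hxB) ?_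
        refine hh.trans ?_
        have hsub : Metric.closedBall c r ⊆ Metric.closedBall c₀ (5 * r₀) := by
          apply Metric.closedBall_subset_closedBall'
          have := dist_triangle c x c₀
          rw [dist_comm c x] at this
          have h1 : dist x c ≤ r := hxB
          have h2 : dist x c₀ ≤ r₀ := hxQ
          linarith
        gcongr
        · exact hJ0 _
        · exact setIntegral_mono_set (hfi c₀ _ (by linarith))
            (Filter.Eventually.of_forall fun x => mul_nonneg (by positivity) (h.nonneg x))
            (Filter.Eventually.of_forall hsub)
      · refine le_max_of_le_right ?_
        have hsub : Q ⊆ Metric.closedBall c (5 * r) := by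
          apply Metric.closedBall_subset_closedBall'
          have := dist_triangle c₀ x c
          rw [dist_comm c₀ x] at this
          have h1 : dist x c ≤ r := hxB
          have h2 : dist x c₀ ≤ r₀ := hxQ
          linarith
        have hmm : mQ / D ≤ m := by
          rw [div_le_iff₀' hD0]
          refine le_trans ?_ (h.doubling c hr)
          exact setIntegral_mono_set (locInt_cb h.loc _ _) (Filter.Eventually.of_forall h.nonneg)
            (Filter.Eventually.of_forall hsub)
        calc m ^ (s - 1) * ∫ y in Metric.closedBall c r, |f y| * μ y
            ≤ m ^ (s - 1) * ((m ^ κ * N ^ p) ^ (1 / p) * m ^ (1 - 1 / p)) := by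
              gcongr
              refine hh.trans ?_
              gcongr
              · exact hJ0 _
              · exact hJN c r hr
          _ = (m ^ (s - 1) * m ^ (κ * (1 / p)) * m ^ (1 - 1 / p)) * N := by
              rw [Real.mul_rpow (by positivity) (by positivity), ← Real.rpow_mul hm0.le,
                ← Real.rpow_mul hN0, mul_one_div_cancel hp0.ne', Real.rpow_one]
              ring
          _ = m ^ (-e) * N := by
              rw [← Real.rpow_add hm0, ← Real.rpow_add hm0]
              congr 2
              rw [he, hq]; ring
          _ ≤ T := by
              rw [hT]
              exact mul_le_mul_of_nonneg_right
                (Real.rpow_le_rpow_of_nonpos (by positivity) hmm (by linarith)) hN0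
  -- integrate
  set S : ℝ := (K₁ * L) ^ q * (D ^ p * J ^ (q * s) * (K₂ * J) + T ^ q * mQ) with hS
  have hS0 : 0 ≤ S := by positivity
  have hcomInt : ∫ x in Q, |maxCommutator b f x| ^ q * μ x ^ (1 - q) ≤ S := by
    refine integral_le_of_lintegral (k := fun x => (K₁ * L) ^ q *
      (D ^ p * J ^ (q * s) * (Ψ x ^ p * μ x) + T ^ q * μ x)) hS0
      (Filter.Eventually.of_forall fun x => by have := h.nonneg x; positivity) ?_ ?_
    · rw [Filter.EventuallyLE, ae_restrict_iff' hQm]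
      filter_upwards [hbound, h.pos] with x hx hμx hxQ
      obtain ⟨ha, hbx⟩ := hx hxQ
      have hΨx := hΨ0 x
      set X := (D * Ψ x) ^ (p / q) * J ^ s with hX
      have hX0 : 0 ≤ X := by positivity
      have hXq : X ^ q = D ^ p * J ^ (q * s) * Ψ x ^ p := by
        rw [hX, Real.mul_rpow (by positivity) (by positivity), ← Real.rpow_mul (by positivity),
          ← Real.rpow_mul hJnn, div_mul_cancel₀ _ hq0.ne', Real.mul_rpow hD0.le hΨx, mul_comm s q]
        ring
      have hmaxq : (max X T) ^ q ≤ X ^ q + T ^ q := by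
        have h1 : 0 ≤ X ^ q := by positivity
        have h2 : 0 ≤ T ^ q := by positivity
        rcases max_cases X T with ⟨h3, -⟩ | ⟨h3, -⟩ <;> rw [h3] <;> linarith
      have hmx0 : 0 ≤ max X T := le_max_of_le_left hX0
      rw [abs_of_nonneg ha]
      calc maxCommutator b f x ^ q * μ x ^ (1 - q)
          ≤ (K₁ * L * μ x * max X T) ^ q * μ x ^ (1 - q) := by gcongr
        _ = (K₁ * L) ^ q * (max X T) ^ q * (μ x ^ q * μ x ^ (1 - q)) := by
            rw [Real.mul_rpow (by positivity) hmx0, Real.mul_rpow (by positivity) hμx.le]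
            ring
        _ = (K₁ * L) ^ q * (max X T) ^ q * μ x := by
            rw [← Real.rpow_add hμx]; simp
        _ ≤ (K₁ * L) ^ q * (X ^ q + T ^ q) * μ x := by gcongr
        _ = _ := by rw [hXq]; ring
    · have hμm : AEMeasurable μ (volume.restrict Q) := (locInt_cb h.loc c₀ r₀).aemeasurable
      have hT' : ∫⁻ x in Q, ENNReal.ofReal (μ x) = ENNReal.ofReal mQ :=
        (ofReal_integral_eq_lintegral_ofReal (locInt_cb h.loc c₀ r₀)
          (Filter.Eventually.of_forall h.nonneg)).symm
      have e1 : ∀ x, ENNReal.ofReal ((K₁ * L) ^ q *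
          (D ^ p * J ^ (q * s) * (Ψ x ^ p * μ x) + T ^ q * μ x)) =
          ENNReal.ofReal ((K₁ * L) ^ q) * (ENNReal.ofReal (D ^ p * J ^ (q * s)) *
            ENNReal.ofReal (Ψ x ^ p * μ x) + ENNReal.ofReal (T ^ q) * ENNReal.ofReal (μ x)) := by
        intro x
        have h1 := h.nonneg x
        have h2 := hΨ0 x
        rw [ENNReal.ofReal_mul (by positivity), ENNReal.ofReal_add (by positivity) (by positivity),
          ENNReal.ofReal_mul (p := D ^ p * J ^ (q * s)) (by positivity),
          ENNReal.ofReal_mul (p := T ^ q) (by positivity)]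
      simp only [e1]
      rw [lintegral_const_mul' _ _ (by simp), lintegral_add_right' _ (by fun_prop),
        lintegral_const_mul' _ _ (by simp), lintegral_const_mul' _ _ (by simp), hT', hS,
        ENNReal.ofReal_mul (p := (K₁ * L) ^ q) (by positivity),
        ENNReal.ofReal_add (by positivity) (by positivity),
        ENNReal.ofReal_mul (p := D ^ p * J ^ (q * s)) (by positivity),
        ENNReal.ofReal_mul (p := T ^ q) (by positivity)]
      gcongr
      exact (lintegral_mono' Measure.restrict_le_self le_rfl).trans hΨint
  -- final constants
  have hSle : S ≤ (K₁ * L) ^ q * (W * (mQ ^ (κ * q / p) * N ^ q)) := by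
    rw [hS]
    have hJ1 : J ≤ (D * mQ) ^ κ * N ^ p := by
      refine (hJN c₀ (5 * r₀) (by linarith)).trans ?_
      gcongr
      · exact (h.int_pos c₀ (by linarith : 0 < 5 * r₀)).le
      · exact h.doubling c₀ hr₀
    have hJ2 : J ^ (q * s) * J = J ^ (q / p) := by
      rw [← hqp, Real.rpow_add_one' hJnn (by positivity)]
    have hJ3 : J ^ (q / p) ≤ D ^ (κ * q / p) * (mQ ^ (κ * q / p) * N ^ q) := by
      refine (Real.rpow_le_rpow hJnn hJ1 (by positivity)).trans (le_of_eq ?_)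
      rw [Real.mul_rpow (by positivity) (by positivity), Real.mul_rpow hD0.le hmQ0.le,
        Real.mul_rpow (by positivity) (by positivity), ← Real.rpow_mul hD0.le,
        ← Real.rpow_mul hmQ0.le, ← Real.rpow_mul hN0, mul_div_cancel₀ _ hp0.ne', mul_div_assoc]
      ring
    have hT1 : T ^ q * mQ = D ^ (1 - κ * q / p) * (mQ ^ (κ * q / p) * N ^ q) := by
      have heq : -e * q = κ * q / p - 1 := by
        rw [he]; field_simp; ring
      rw [hT, Real.mul_rpow (by positivity) hN0, ← Real.rpow_mul (by positivity), heq,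
        Real.div_rpow hmQ0.le hD0.le, Real.rpow_sub_one hmQ0.ne',
        show (1 - κ * q / p) = -(κ * q / p - 1) by ring, Real.rpow_neg hD0.le]
      field_simp
    have : D ^ p * J ^ (q * s) * (K₂ * J) = D ^ p * K₂ * J ^ (q / p) := by rw [← hJ2]; ring
    rw [this, hT1]
    refine mul_le_mul_of_nonneg_left ?_ (by positivity)
    calc D ^ p * K₂ * J ^ (q / p) + D ^ (1 - κ * q / p) * (mQ ^ (κ * q / p) * N ^ q)
        ≤ D ^ p * K₂ * (D ^ (κ * q / p) * (mQ ^ (κ * q / p) * N ^ q)) +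
          D ^ (1 - κ * q / p) * (mQ ^ (κ * q / p) * N ^ q) := by gcongr
      _ = _ := by rw [hW]; ring
  have hlast : mQ ^ (-(κ * q / p)) * ∫ x in Q, |maxCommutator b f x| ^ q * μ x ^ (1 - q) ≤
      (K₁ * W ^ (1 / q) * L * N) ^ q := by
    calc _ ≤ mQ ^ (-(κ * q / p)) * ((K₁ * L) ^ q * (W * (mQ ^ (κ * q / p) * N ^ q))) := by
          gcongr; exact hcomInt.trans hSle
      _ = (mQ ^ (-(κ * q / p)) * mQ ^ (κ * q / p)) * ((K₁ * L) ^ q * W * N ^ q) := by ring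
      _ = (K₁ * L) ^ q * W * N ^ q := by
          rw [← Real.rpow_add hmQ0]; simp
      _ = _ := by
          rw [show K₁ * W ^ (1 / q) * L * N = (K₁ * L) * W ^ (1 / q) * N by ring,
            Real.mul_rpow (by positivity) hN0, Real.mul_rpow (x := K₁ * L) (y := W ^ (1 / q)) (by positivity)
              (by positivity), ← Real.rpow_mul hW0.le, one_div_mul_cancel hq0.ne', Real.rpow_one]
  have hnn : 0 ≤ ∫ x in Q, |maxCommutator b f x| ^ q * μ x ^ (1 - q) :=
    integral_nonneg fun x => by have := h.nonneg x; positivity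
  calc _ ≤ ((K₁ * W ^ (1 / q) * L * N) ^ q) ^ (1 / q) :=
        Real.rpow_le_rpow (by positivity) hlast (by positivity)
    _ = _ := by
        rw [← Real.rpow_mul (by positivity), mul_one_div_cancel hq0.ne', Real.rpow_one]

/-- `(1) ⇒ (2)` of Theorem 1.1, quantitatively: `M_b` maps `L^{p,κ}(μ)` to
`L^{q,κq/p}(μ^{1-q}, μ)` with norm controlled by `‖b‖_{Lip_{β,μ}}`. -/
theorem maximal_commutator_bounded
    (n : ℕ) (hn : 1 ≤ n) (μ : (Fin n → ℝ) → ℝ) (hμ : IsA1 μ)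
    (β p q κ : ℝ) (hβ0 : 0 < β) (hβ1 : β < 1)
    (hp1 : 1 < p) (hpn : p < n / β)
    (hq : 1 / q = 1 / p - β / n) (hκ0 : 0 < κ) (hκ : κ < p / q) :
    ∃ C > 0, ∀ b : (Fin n → ℝ) → ℝ, MemLip β μ b →
      ∀ f : (Fin n → ℝ) → ℝ, MemMorrey p κ μ f →
        morreyNorm2 q (κ * q / p) (fun x => μ x ^ (1 - q)) μ (maxCommutator b f) ≤
          C * lipNorm β μ b * morreyNorm p κ μ f := by
  obtain ⟨C, h⟩ := goodW_of_A1 hμ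
  exact h.main hn hβ0 hp1 hpn hq hκ0 hκ

end
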